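/- Let U be an open subset of ℂ containing the closed unit ball, and let h : ℂ → ℂ be complex-differentiable on U. Suppose h(z) ≠ 0 for every z with ‖z‖ = 1, and suppose the restriction of h to the unit circle, viewed as a continuous map from the unit circle into ℂ \ {0}, is homotopic to a constant map. Then h(z) ≠ 0 for every z in the closed unit ball. -/

import Mathlib

open Complex
lemma trig_split (u : C(AddCircle (1:ℝ), ℂ)) (hu : u ∈ Submodule.span ℂ (Set.range (@fourier (1:ℝ)))) :
    ∃ F G : ℂ → ℂ, Differentiable ℂ F ∧ Differentiable ℂ G ∧
      ∀ t, u t = F (AddCircle.toCircle t) + (starRingEnd ℂ) (G (AddCircle.toCircle t)) := by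
  induction hu using Submodule.span_induction with
  | mem x hx =>
    obtain ⟨n, rfl⟩ := hx
    rcases Int.eq_nat_or_neg n with ⟨m, rfl | rfl⟩
    · refine ⟨fun z => z ^ m, fun _ => 0, by fun_prop, by fun_prop, fun t => ?_⟩
      simp [fourier_apply, AddCircle.toCircle_nsmul]
    · refine ⟨fun _ => 0, fun z => z ^ m, by fun_prop, by fun_prop, fun t => ?_⟩
      rw [fourier_neg]
      simp [fourier_apply, AddCircle.toCircle_nsmul]
  | zero => exact ⟨fun _ => 0, fun _ => 0, by fun_prop, by fun_prop, by simp⟩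
  | add x y _ _ hx hy =>
    obtain ⟨F, G, hF, hG, h1⟩ := hx
    obtain ⟨F', G', hF', hG', h2⟩ := hy
    refine ⟨fun z => F z + F' z, fun z => G z + G' z, by fun_prop, by fun_prop, fun t => ?_⟩
    simp only [ContinuousMap.add_apply, h1, h2, map_add]; ring
  | smul a x _ hx =>
    obtain ⟨F, G, hF, hG, h1⟩ := hx
    refine ⟨fun z => a * F z, fun z => starRingEnd ℂ a * G z, by fun_prop, by fun_prop, fun t => ?_⟩
    simp only [ContinuousMap.smul_apply, h1, map_mul, smul_eq_mul, Complex.conj_conj]; ring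

lemma approx_im (L : C({z : ℂ // ‖z‖ = 1}, ℂ)) :
    ∃ F : ℂ → ℂ, Differentiable ℂ F ∧ ∀ z : {z : ℂ // ‖z‖ = 1}, |(L z - F z).im| < 1 := by
  have : Fact (0 < (1:ℝ)) := ⟨one_pos⟩
  let u : C(AddCircle (1:ℝ), ℂ) := ⟨fun t => L ⟨AddCircle.toCircle t, Circle.norm_coe _⟩, by
    have := AddCircle.continuous_toCircle (T := (1:ℝ))
    fun_prop⟩
  have hu : u ∈ (Submodule.span ℂ (Set.range (@fourier (1:ℝ)))).topologicalClosure := by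
    rw [span_fourier_closure_eq_top]; trivial
  obtain ⟨v, hv, hd⟩ := Metric.mem_closure_iff.1 hu 1 one_pos
  obtain ⟨F, G, hF, hG, h1⟩ := trig_split v hv
  refine ⟨fun z => F z - G z, by fun_prop, fun z => ?_⟩
  obtain ⟨t, ht⟩ : ∃ t : AddCircle (1:ℝ), (AddCircle.toCircle t : ℂ) = z := by
    obtain ⟨t, ht⟩ := (AddCircle.homeomorphCircle (T := 1) one_ne_zero).surjective ⟨z, by simp [Submonoid.unitSphere, z.2]⟩
    exact ⟨t, by rw [← AddCircle.homeomorphCircle_apply one_ne_zero, ht]⟩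
  have h2 : dist (u t) (v t) < 1 := (ContinuousMap.dist_apply_le_dist t).trans_lt hd
  have h3 : u t = L z := by simp [u, ht]
  rw [dist_eq_norm, h3, h1, ht] at h2
  refine lt_of_le_of_lt (le_of_eq ?_) ((Complex.abs_im_le_norm _).trans_lt h2)
  simp [sub_eq_add_neg]

lemma exists_log (f : C({z : ℂ // ‖z‖ = 1}, {w : ℂ // w ≠ 0})) (c : {w : ℂ // w ≠ 0})
    (H : ContinuousMap.Homotopic f (ContinuousMap.const _ c)) :
    ∃ L : C({z : ℂ // ‖z‖ = 1}, ℂ), ∀ z, exp (L z) = f z := by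
  obtain ⟨K⟩ := H.symm
  have H0 : ∀ a, K.toContinuousMap (0, a) = (⟨exp (ContinuousMap.const {z : ℂ // ‖z‖ = 1} (log c) a), exp_ne_zero _⟩ : {w : ℂ // w ≠ 0}) := by
    intro a
    ext
    simp [exp_log c.2]
  let M := isCoveringMap_exp.liftHomotopy K.toContinuousMap (.const _ (log c)) H0
  refine ⟨⟨fun z => M (1, z), by fun_prop⟩, fun z => ?_⟩
  have := congrArg Subtype.val (congrFun (isCoveringMap_exp.liftHomotopy_lifts K.toContinuousMap (.const _ (log c)) H0) (1, z))
  exact this.trans (congrArg Subtype.val (K.apply_one z))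

/-- If `h` is holomorphic on an open set containing the closed unit ball,
nonvanishing on the unit circle, and its restriction to the unit circle is null homotopic as a
map into `ℂ \ {0}`, then `h` has no zeros in the closed unit ball. -/
theorem no_zeros_of_nullhomotopic_boundary
    (U : Set ℂ) (hU : IsOpen U) (hball : Metric.closedBall (0 : ℂ) 1 ⊆ U)
    (h : ℂ → ℂ) (hdiff : DifferentiableOn ℂ h U)
    (hne : ∀ z : ℂ, ‖z‖ = 1 → h z ≠ 0)
    (hnull : ∃ (f : C({z : ℂ // ‖z‖ = 1}, {w : ℂ // w ≠ 0}))
        (c : {w : ℂ // w ≠ 0}),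
        (∀ z : {z : ℂ // ‖z‖ = 1}, (f z : ℂ) = h z) ∧
        ContinuousMap.Homotopic f (ContinuousMap.const _ c)) :
    ∀ z ∈ Metric.closedBall (0 : ℂ) 1, h z ≠ 0 := by
  obtain ⟨f, c, hf, H⟩ := hnull
  obtain ⟨L, hL⟩ := exists_log f c H
  obtain ⟨F, hF, hLF⟩ := approx_im L
  have hk : DifferentiableOn ℂ (fun z => h z * exp (-F z)) U :=
    hdiff.mul (by fun_prop)
  have hpos : ∀ z ∈ Metric.sphere (0 : ℂ) 1, 0 < (h z * exp (-F z)).re := by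
    intro z hz
    have hz : ‖z‖ = 1 := by simpa using hz
    have e1 := hLF ⟨z, hz⟩
    rw [← hf ⟨z, hz⟩, ← hL, ← exp_add, ← sub_eq_add_neg, exp_re]
    refine mul_pos (Real.exp_pos _) (Real.cos_pos_of_mem_Ioo ?_)
    have := abs_lt.1 e1
    constructor <;> linarith [Real.pi_gt_three]
  obtain ⟨w, hw, hmin⟩ := (isCompact_sphere (0 : ℂ) 1).exists_isMinOn
    ⟨1, by simp⟩ (f := fun z => (h z * exp (-F z)).re)
    (continuous_re.comp_continuousOn (hk.continuousOn.mono
      (Metric.sphere_subset_closedBall.trans hball)))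
  intro z hz h0
  have key := Complex.norm_le_of_forall_mem_frontier_norm_le (U := Metric.ball (0 : ℂ) 1)
    (f := fun z => exp (-(h z * exp (-F z)))) (C := Real.exp (-(h w * exp (-F w)).re)) Metric.isBounded_ball
    (by
      have : DifferentiableOn ℂ (fun z => exp (-(h z * exp (-F z)))) U := hk.neg.cexp
      refine DifferentiableOn.diffContOnCl (this.mono ?_)
      rwa [closure_ball _ one_ne_zero])
    (by
      intro x hx
      rw [frontier_ball _ one_ne_zero] at hx
      rw [norm_exp, neg_re]
      have := isMinOn_iff.1 hmin x hx
      gcongr) (z := z) (by rwa [closure_ball _ one_ne_zero])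
  have := hpos w hw
  simp [h0] at key
  simp at this
  linarith
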